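/- arXiv:1805.11769 — 7 statements merged into one kernel-verified Lean document; each statement's English description precedes it below -/
import Mathlib

section
/- Let W be a symmetric n×n real matrix with nonnegative entries and zero diagonal, not identically zero, with nodal strengths s_i = Σ_j W_{ij}, total strength S = Σ_i s_i > 0, and c = 1/S. Let λ_1, …, λ_n be the eigenvalues of the trace-normalized Laplacian L_N = c·(diag(s) − W). Then the quadratic approximation Q = Σ_{i=1}^n λ_i (1 − λ_i) = 1 − Σ_{i=1}^n λ_i² of the von Neumann graph entropy satisfies Q = 1 − c² ( Σ_{i=1}^n s_i² + Σ_{i≠j} W_{ij}² ). -/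
/-- The trace of the square of a real symmetric matrix is the sum of its squared eigenvalues. -/
theorem Matrix.IsHermitian.trace_mul_self_eq_sum_eigenvalues_sq {ι : Type*} [Fintype ι]
    [DecidableEq ι] {A : Matrix ι ι ℝ} (hA : A.IsHermitian) :
    (A * A).trace = ∑ i, hA.eigenvalues i ^ 2 := by
  conv_lhs => rw [hA.spectral_theorem, ← map_mul, Unitary.conjStarAlgAut_apply,
    trace_mul_comm, ← mul_assoc, Unitary.coe_star_mul_self, one_mul, diagonal_mul_diagonal,
    trace_diagonal]
  simp [sq]

/-- The trace of the square of `diagonal s - W`, for `W` symmetric with zero diagonal. -/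
theorem Matrix.trace_diagonal_sub_mul_self {ι : Type*} [Fintype ι] [DecidableEq ι]
    {W : Matrix ι ι ℝ} (hsymm : W.IsSymm) (hdiag : ∀ i, W i i = 0) (s : ι → ℝ) :
    ((diagonal s - W) * (diagonal s - W)).trace
      = ∑ i, s i ^ 2 + ∑ i, ∑ j ∈ Finset.univ.filter (fun j => j ≠ i), W i j ^ 2 := by
  simp only [trace, diag_apply, mul_apply, ← Finset.sum_add_distrib]
  refine Finset.sum_congr rfl fun i _ => ?_
  rw [Finset.filter_ne', ← Finset.add_sum_erase _ _ (Finset.mem_univ i)]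
  congr 1
  · simp [hdiag, sq]
  · refine Finset.sum_congr rfl fun j hj => ?_
    have hji : j ≠ i := Finset.ne_of_mem_erase hj
    simp [diagonal_apply_ne _ hji, diagonal_apply_ne _ hji.symm, hsymm.apply i j, sq]


/-- **Lemma 1 (Quadratic approximation Q of H).**
For a weighted undirected graph with symmetric nonnegative weight matrix `W`
(zero diagonal, not identically zero), nodal strengths `s i = ∑ j, W i j`,
total strength `S = ∑ i, s i > 0` and `c = 1/S`, the quadratic approximation
`Q = ∑ i, λ i * (1 - λ i) = 1 - ∑ i, (λ i)^2` of the von Neumann graph entropy,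
where `λ` are the eigenvalues of the trace-normalized Laplacian
`L_N = c • (diag s - W)`, satisfies
`Q = 1 - c^2 * (∑ i, (s i)^2 + ∑_{i ≠ j} (W i j)^2)`. -/
theorem quadratic_approximation_of_vnge {n : ℕ}
    (W : Matrix (Fin n) (Fin n) ℝ)
    (hsymm : W.IsSymm)
    (hnonneg : ∀ i j, 0 ≤ W i j)
    (hdiag : ∀ i, W i i = 0)
    (hW : W ≠ 0)
    (s : Fin n → ℝ) (hs : ∀ i, s i = ∑ j, W i j)
    (S : ℝ) (hS : S = ∑ i, s i) (hSpos : 0 < S)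
    (c : ℝ) (hc : c = 1 / S)
    (LN : Matrix (Fin n) (Fin n) ℝ)
    (hLN : LN = c • (Matrix.diagonal s - W))
    (hH : LN.IsHermitian) :
    (∑ i, hH.eigenvalues i * (1 - hH.eigenvalues i))
      = 1 - ∑ i, (hH.eigenvalues i) ^ 2
    ∧ 1 - ∑ i, (hH.eigenvalues i) ^ 2
      = 1 - c ^ 2 * ((∑ i, (s i) ^ 2)
          + ∑ i, ∑ j ∈ Finset.univ.filter (fun j => j ≠ i), (W i j) ^ 2) := by
  have htr : ∑ i, hH.eigenvalues i = 1 := by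
    have h : LN.trace = ∑ i, hH.eigenvalues i := by simpa using hH.trace_eq_sum_eigenvalues
    rw [← h, hLN, Matrix.trace_smul, Matrix.trace_sub, Matrix.trace_diagonal, ← hS]
    simp [Matrix.trace, hdiag, hc, hSpos.ne']
  constructor
  · simp only [mul_sub, mul_one, Finset.sum_sub_distrib, htr, sq]
  · rw [← hH.trace_mul_self_eq_sum_eigenvalues_sq, ← Matrix.trace_diagonal_sub_mul_self hsymm hdiag,
      hLN, Matrix.smul_mul, Matrix.mul_smul, smul_smul, Matrix.trace_smul, smul_eq_mul, sq]
end

section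
/- Let W be a symmetric n×n real matrix with nonnegative entries and zero diagonal, not identically zero, and let λ_1 ≥ … ≥ λ_n ≥ 0 be the eigenvalues of the trace-normalized Laplacian L_N. Let λ_max be the largest eigenvalue and λ_min the smallest strictly positive eigenvalue of L_N, let H = −Σ_i λ_i ln λ_i be the von Neumann graph entropy (with 0 ln 0 = 0), and let Q = 1 − Σ_i λ_i². If λ_max < 1, then −Q · (ln λ_max)/(1 − λ_min) ≤ H ≤ −Q · (ln λ_min)/(1 − λ_max). -/
/-- Entropy bounds for a finite probability vector whose positive entries lie in `[a, b]`,
in terms of its quadratic entropy. -/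
theorem entropy_bounds_of_mem_Icc {ι : Type*} [Fintype ι] {p : ι → ℝ} {a b : ℝ}
    (hp : ∀ i, 0 ≤ p i) (hsum : ∑ i, p i = 1) (ha : 0 < a) (hab : a ≤ b) (hb : b < 1)
    (hpa : ∀ i, 0 < p i → a ≤ p i) (hpb : ∀ i, p i ≤ b) :
    -(1 - ∑ i, p i ^ 2) * Real.log b / (1 - a) ≤ -∑ i, p i * Real.log (p i) ∧
      -∑ i, p i * Real.log (p i) ≤ -(1 - ∑ i, p i ^ 2) * Real.log a / (1 - b) := by
  have hQ : 1 - ∑ i, p i ^ 2 = ∑ i, p i * (1 - p i) := by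
    simp only [mul_sub, mul_one, Finset.sum_sub_distrib, hsum, sq]
  have hlogb : Real.log b < 0 := Real.log_neg (ha.trans_le hab) hb
  have hloga : Real.log a < 0 := Real.log_neg ha (hab.trans_lt hb)
  rw [hQ, div_le_iff₀ (by linarith), le_div_iff₀ (by linarith), ← Finset.sum_neg_distrib,
    ← Finset.sum_neg_distrib, Finset.sum_mul, Finset.sum_mul, Finset.sum_mul, Finset.sum_mul]
  constructor <;> refine Finset.sum_le_sum fun i _ => ?_ <;>
    rcases (hp i).eq_or_lt with h | h
  · simp [← h]
  · have hlog : Real.log (p i) ≤ Real.log b := Real.log_le_log h (hpb i)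
    have key : (1 - p i) * -Real.log b ≤ (1 - a) * -Real.log (p i) :=
      mul_le_mul (by linarith [hpa i h]) (by linarith) (by linarith) (by linarith)
    nlinarith [mul_le_mul_of_nonneg_left key h.le]
  · simp [← h]
  · have hlog : Real.log a ≤ Real.log (p i) := Real.log_le_log ha (hpa i h)
    have hlog' : Real.log (p i) ≤ 0 := Real.log_nonpos h.le ((hpb i).trans hb.le)
    have key : (1 - b) * -Real.log (p i) ≤ (1 - p i) * -Real.log a :=
      mul_le_mul (by linarith [hpb i]) (by linarith) (by linarith) (by linarith [hpb i])
    nlinarith [mul_le_mul_of_nonneg_left key h.le]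

/-- A real Hermitian matrix that is weakly diagonally dominant with nonnegative diagonal
has nonnegative eigenvalues. -/
theorem Matrix.IsHermitian.eigenvalues_nonneg_of_diagonally_dominant {ι : Type*} [Fintype ι]
    [DecidableEq ι] {A : Matrix ι ι ℝ} (hA : A.IsHermitian)
    (h : ∀ k, ∑ j ∈ Finset.univ.erase k, ‖A k j‖ ≤ A k k) (i : ι) : 0 ≤ hA.eigenvalues i := by
  have hev : Module.End.HasEigenvalue (Matrix.toLin' A) (hA.eigenvalues i) := by
    rw [Module.End.hasEigenvalue_iff_mem_spectrum, Matrix.spectrum_toLin']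
    exact hA.eigenvalues_mem_spectrum_real i
  obtain ⟨k, hk⟩ := eigenvalue_mem_ball hev
  rw [Metric.mem_closedBall, Real.dist_eq] at hk
  linarith [neg_abs_le (hA.eigenvalues i - A k k), h k]

/-- **Theorem 1 (Approximation bounds on H).**
Let `λ` be the eigenvalues of the trace-normalized Laplacian `L_N` of a weighted
undirected graph (symmetric, nonnegative, zero-diagonal, nonzero weight matrix `W`).
Let `lmax` be the largest eigenvalue and `lmin` the smallest strictly positive
eigenvalue of `L_N`, `H = -∑ i, λ i * ln (λ i)` the von Neumann graph entropy
(with `0 ln 0 = 0`, as in Mathlib `Real.log 0 = 0`), and `Q = 1 - ∑ i, (λ i)^2`.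
If `lmax < 1`, then `-Q * ln lmax / (1 - lmin) ≤ H ≤ -Q * ln lmin / (1 - lmax)`. -/
theorem vnge_approximation_bounds {n : ℕ}
    (W : Matrix (Fin n) (Fin n) ℝ)
    (hsymm : W.IsSymm)
    (hnonneg : ∀ i j, 0 ≤ W i j)
    (hdiag : ∀ i, W i i = 0)
    (hW : W ≠ 0)
    (LN : Matrix (Fin n) (Fin n) ℝ)
    (hLN : LN = (Matrix.diagonal (fun i => ∑ j, W i j) - W).trace⁻¹ •
        (Matrix.diagonal (fun i => ∑ j, W i j) - W))
    (hH : LN.IsHermitian)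
    (lmax lmin : ℝ)
    (hlmax : IsGreatest {x | ∃ i, hH.eigenvalues i = x} lmax)
    (hlmin : IsLeast {x | 0 < x ∧ ∃ i, hH.eigenvalues i = x} lmin)
    (H Q : ℝ)
    (hHdef : H = -∑ i, hH.eigenvalues i * Real.log (hH.eigenvalues i))
    (hQdef : Q = 1 - ∑ i, (hH.eigenvalues i) ^ 2)
    (hlt : lmax < 1) :
    -Q * Real.log lmax / (1 - lmin) ≤ H ∧ H ≤ -Q * Real.log lmin / (1 - lmax) := by
  set L := Matrix.diagonal (fun i => ∑ j, W i j) - W with hL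
  have hLdiag : ∀ i, L i i = ∑ j, W i j := fun i => by simp [hL, hdiag]
  have htrace : L.trace = ∑ i, ∑ j, W i j := Finset.sum_congr rfl fun i _ => hLdiag i
  have hpos : 0 < L.trace := by
    have hrow : ∀ i, 0 ≤ ∑ j, W i j := fun i => Finset.sum_nonneg fun j _ => hnonneg i j
    rw [htrace]
    refine (Finset.sum_nonneg fun i _ => hrow i).lt_of_ne' fun h0 => hW ?_
    ext i j
    have hi := (Finset.sum_eq_zero_iff_of_nonneg fun i _ => hrow i).1 h0 i (Finset.mem_univ i)
    exact (Finset.sum_eq_zero_iff_of_nonneg fun j _ => hnonneg i j).1 hi j (Finset.mem_univ j)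
  have hsum : ∑ i, hH.eigenvalues i = 1 := by
    have ht : LN.trace = 1 := by
      rw [hLN, Matrix.trace_smul, smul_eq_mul, inv_mul_cancel₀ hpos.ne']
    simpa [ht] using hH.trace_eq_sum_eigenvalues.symm
  have hev : ∀ i, 0 ≤ hH.eigenvalues i := by
    refine hH.eigenvalues_nonneg_of_diagonally_dominant fun k => ?_
    have hoff : ∀ j ∈ Finset.univ.erase k, ‖LN k j‖ = L.trace⁻¹ * W k j := fun j hj => by
      have hkj : k ≠ j := (Finset.ne_of_mem_erase hj).symm
      have hLkj : L k j = -W k j := by simp [hL, hkj]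
      rw [hLN, Matrix.smul_apply, hLkj, smul_eq_mul, norm_mul, norm_neg,
        Real.norm_of_nonneg (inv_nonneg.2 hpos.le), Real.norm_of_nonneg (hnonneg k j)]
    rw [Finset.sum_congr rfl hoff, ← Finset.mul_sum, hLN, Matrix.smul_apply, hLdiag, smul_eq_mul]
    exact mul_le_mul_of_nonneg_left (Finset.sum_le_sum_of_subset_of_nonneg
      (Finset.erase_subset _ _) fun j _ _ => hnonneg k j) (inv_nonneg.2 hpos.le)
  obtain ⟨⟨hminpos, i₀, hi₀⟩, hminle⟩ := hlmin
  subst hHdef hQdef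
  exact entropy_bounds_of_mem_Icc hev hsum hminpos (hlmax.2 ⟨i₀, hi₀⟩) hlt
    (fun i hi => hminle ⟨hi, i, rfl⟩) (fun i => hlmax.2 ⟨i, rfl⟩)
end

section
/- For each n, let W_n be a symmetric n×n real matrix with nonnegative entries and zero diagonal, not identically zero, with trace-normalized Laplacian eigenvalues λ^{(n)}_1 ≥ … ≥ λ^{(n)}_n ≥ 0 summing to 1; let n_+(n) be the number of strictly positive eigenvalues, λ_max(n) the largest eigenvalue, λ_min(n) the smallest strictly positive eigenvalue, H_n the von Neumann graph entropy, and Q_n = 1 − Σ_i (λ^{(n)}_i)². Suppose there exist constants α > 0 and β > 0 such that for all sufficiently large n, n_+(n) ≥ α·n, λ_max(n) < 1, and λ_min(n) ≥ β·λ_max(n). Then H_n/ln n − Q_n → 0 as n → ∞. -/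
/-- Deviation of the normalized entropy from `1` for a probability vector whose positive entries
all lie in `[b / N, C / N]`. -/
theorem abs_entropy_sub_log_le {ι : Type*} [Fintype ι] {p : ι → ℝ} {N b C : ℝ}
    (hN : 0 < N) (hb : 0 < b) (hp : ∀ i, 0 ≤ p i) (hsum : ∑ i, p i = 1)
    (hlow : ∀ i, 0 < p i → b ≤ N * p i) (hupp : ∀ i, N * p i ≤ C) :
    |-∑ i, p i * Real.log (p i) - Real.log N| ≤ |Real.log b| + |Real.log C| := by
  have key : -∑ i, p i * Real.log (p i) - Real.log N = -∑ i, p i * Real.log (N * p i) := by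
    have h : ∀ i, p i * Real.log (N * p i) = p i * Real.log N + p i * Real.log (p i) := by
      intro i
      rcases (hp i).eq_or_lt with h | h
      · simp [← h]
      · rw [Real.log_mul hN.ne' h.ne']
        ring
    simp only [h, Finset.sum_add_distrib, ← Finset.sum_mul, hsum]
    ring
  rw [key, abs_neg]
  calc |∑ i, p i * Real.log (N * p i)| ≤ ∑ i, |p i * Real.log (N * p i)| :=
        Finset.abs_sum_le_sum_abs _ _
    _ ≤ ∑ i, p i * (|Real.log b| + |Real.log C|) := by
        refine Finset.sum_le_sum fun i _ => ?_
        rw [abs_mul, abs_of_nonneg (hp i)]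
        rcases (hp i).eq_or_lt with h | h
        · simp [← h]
        · refine mul_le_mul_of_nonneg_left ?_ (hp i)
          have h1 := Real.log_le_log hb (hlow i h)
          have h2 := Real.log_le_log (mul_pos hN h) (hupp i)
          rw [abs_le]
          constructor
          · linarith [neg_abs_le (Real.log b), abs_nonneg (Real.log C)]
          · linarith [le_abs_self (Real.log C), abs_nonneg (Real.log b)]
    _ = |Real.log b| + |Real.log C| := by rw [← Finset.sum_mul, hsum, one_mul]

/-- A probability vector with entries at most `c` has sum of squares at most `c`. -/
theorem sum_sq_le_of_le {ι : Type*} [Fintype ι] {p : ι → ℝ} {c : ℝ}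
    (hp : ∀ i, 0 ≤ p i) (hsum : ∑ i, p i = 1) (hc : ∀ i, p i ≤ c) :
    ∑ i, p i ^ 2 ≤ c := by
  calc ∑ i, p i ^ 2 ≤ ∑ i, p i * c :=
        Finset.sum_le_sum fun i _ => by
          rw [sq]
          exact mul_le_mul_of_nonneg_left (hc i) (hp i)
    _ = c := by rw [← Finset.sum_mul, hsum, one_mul]

section Laplacian

variable {ι : Type*} [Fintype ι] [DecidableEq ι] {W : Matrix ι ι ℝ}

/-- The trace of a weighted graph Laplacian is positive when some weight is nonzero. -/
theorem trace_laplacian_pos (hnonneg : ∀ i j, 0 ≤ W i j) (hdiag : ∀ i, W i i = 0) (hW : W ≠ 0) :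
    0 < (Matrix.diagonal (fun i => ∑ j, W i j) - W).trace := by
  have htr : (Matrix.diagonal (fun i => ∑ j, W i j) - W).trace = ∑ i, ∑ j, W i j := by
    simp [Matrix.trace, hdiag]
  rw [htr]
  obtain ⟨i, j, hij⟩ : ∃ i j, W i j ≠ 0 := by
    by_contra! h
    exact hW (Matrix.ext h)
  have hrow : ∀ i, 0 ≤ ∑ j, W i j := fun i => Finset.sum_nonneg fun j _ => hnonneg i j
  have hpos : 0 < ∑ j, W i j :=
    Finset.sum_pos' (fun j _ => hnonneg i j)
      ⟨j, Finset.mem_univ _, lt_of_le_of_ne (hnonneg i j) hij.symm⟩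
  exact Finset.sum_pos' (fun i _ => hrow i) ⟨i, Finset.mem_univ _, hpos⟩

/-- Eigenvalues of a nonnegative multiple of a weighted graph Laplacian are nonnegative. -/
theorem eigenvalues_smul_laplacian_nonneg {c : ℝ} (hc : 0 ≤ c) (hnonneg : ∀ i j, 0 ≤ W i j)
    (hdiag : ∀ i, W i i = 0)
    {A : Matrix ι ι ℝ} (hA : A = c • (Matrix.diagonal (fun i => ∑ j, W i j) - W))
    (hherm : A.IsHermitian) (i : ι) : 0 ≤ hherm.eigenvalues i := by
  have hev : Module.End.HasEigenvalue (Matrix.toLin' A) (hherm.eigenvalues i) := by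
    rw [Module.End.hasEigenvalue_iff_mem_spectrum, Matrix.spectrum_toLin']
    exact hherm.eigenvalues_mem_spectrum_real i
  obtain ⟨k, hk⟩ := eigenvalue_mem_ball hev
  have hdiagA : A k k = c * ∑ j, W k j := by simp [hA, hdiag]
  have hrad : ∑ j ∈ Finset.univ.erase k, ‖A k j‖ = c * ∑ j, W k j := by
    rw [← Finset.add_sum_erase Finset.univ (fun j => W k j) (Finset.mem_univ k), hdiag,
      zero_add, Finset.mul_sum]
    refine Finset.sum_congr rfl fun j hj => ?_
    have hkj : k ≠ j := (Finset.ne_of_mem_erase hj).symm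
    simp [hA, hkj, abs_of_nonneg hc, abs_of_nonneg (hnonneg k j)]
  rw [hdiagA, hrad, Metric.mem_closedBall, Real.dist_eq] at hk
  linarith [neg_abs_le (hherm.eigenvalues i - c * ∑ j, W k j)]

end Laplacian

/-- A sequence within bounded distance of `log n` is asymptotic to it. -/
theorem tendsto_div_log_of_abs_sub_log_le {H : ℕ → ℝ} {D : ℝ}
    (h : ∀ᶠ n : ℕ in Filter.atTop, |H n - Real.log n| ≤ D) :
    Filter.Tendsto (fun n => H n / Real.log n) Filter.atTop (nhds 1) := by
  have hlog : Filter.Tendsto (fun n : ℕ => Real.log n) Filter.atTop Filter.atTop :=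
    Real.tendsto_log_atTop.comp tendsto_natCast_atTop_atTop
  rw [tendsto_iff_norm_sub_tendsto_zero]
  refine squeeze_zero' (Filter.Eventually.of_forall fun n => norm_nonneg _) ?_
    (hlog.const_div_atTop D)
  filter_upwards [h, hlog.eventually_gt_atTop 0] with n hn hpos
  rw [Real.norm_eq_abs, div_sub_one hpos.ne', abs_div, abs_of_pos hpos]
  gcongr


/-- **Corollary 1 (Asymptotic equivalence of Q).**
For each `n`, let `W n` be the (symmetric, nonnegative, zero-diagonal, nonzero)
weight matrix of a graph on `n` vertices, with trace-normalized Laplacian `LN n`,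
von Neumann graph entropy `H n`, quadratic approximation `Q n`, largest eigenvalue
`lmax n`, smallest strictly positive eigenvalue `lmin n`, and `n_+` strictly
positive eigenvalues. If there exist constants `α, β > 0` such that for all
sufficiently large `n`, `n_+ ≥ α·n`, `lmax n < 1` and `lmin n ≥ β·lmax n`, then
`H n / ln n - Q n → 0` as `n → ∞`. -/
theorem asymptotic_equivalence_of_Q
    (W : ∀ n : ℕ, Matrix (Fin n) (Fin n) ℝ)
    (hsymm : ∀ n, 2 ≤ n → (W n).IsSymm)
    (hnonneg : ∀ n, 2 ≤ n → ∀ i j, 0 ≤ W n i j)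
    (hdiag : ∀ n, 2 ≤ n → ∀ i, W n i i = 0)
    (hW : ∀ n, 2 ≤ n → W n ≠ 0)
    (LN : ∀ n : ℕ, Matrix (Fin n) (Fin n) ℝ)
    (hLN : ∀ n, LN n = (Matrix.diagonal (fun i => ∑ j, W n i j) - W n).trace⁻¹ •
        (Matrix.diagonal (fun i => ∑ j, W n i j) - W n))
    (hH : ∀ n, (LN n).IsHermitian)
    (lmax lmin : ℕ → ℝ)
    (hlmax : ∀ n, 2 ≤ n → IsGreatest {x | ∃ i, (hH n).eigenvalues i = x} (lmax n))
    (hlmin : ∀ n, 2 ≤ n → IsLeast {x | 0 < x ∧ ∃ i, (hH n).eigenvalues i = x} (lmin n))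
    (H Q : ℕ → ℝ)
    (hHdef : ∀ n, H n = -∑ i, (hH n).eigenvalues i * Real.log ((hH n).eigenvalues i))
    (hQdef : ∀ n, Q n = 1 - ∑ i, ((hH n).eigenvalues i) ^ 2)
    (α β : ℝ) (hα : 0 < α) (hβ : 0 < β)
    (hbig : ∀ᶠ n in Filter.atTop,
      α * n ≤ (Nat.card {i : Fin n // 0 < (hH n).eigenvalues i} : ℝ)
      ∧ lmax n < 1 ∧ β * lmax n ≤ lmin n) :
    Filter.Tendsto (fun n => H n / Real.log n - Q n) Filter.atTop (nhds 0) := by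
  have hnn : ∀ n, 2 ≤ n → ∀ i, 0 ≤ (hH n).eigenvalues i := fun n hn =>
    eigenvalues_smul_laplacian_nonneg
      (inv_nonneg.2 (trace_laplacian_pos (hnonneg n hn) (hdiag n hn) (hW n hn)).le)
      (hnonneg n hn) (hdiag n hn) (hLN n) (hH n)
  have hsum : ∀ n, 2 ≤ n → ∑ i, (hH n).eigenvalues i = 1 := by
    intro n hn
    have h1 : (LN n).trace = 1 := by
      rw [hLN n, Matrix.trace_smul, smul_eq_mul,
        inv_mul_cancel₀ (trace_laplacian_pos (hnonneg n hn) (hdiag n hn) (hW n hn)).ne']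
    rw [← h1, (hH n).trace_eq_sum_eigenvalues]
    simp
  have hbounds : ∀ᶠ n : ℕ in Filter.atTop, 2 ≤ n ∧
      (∀ i, 0 < (hH n).eigenvalues i → β ≤ n * (hH n).eigenvalues i) ∧
      ∀ i, n * (hH n).eigenvalues i ≤ (α * β)⁻¹ := by
    filter_upwards [hbig, Filter.eventually_ge_atTop 2] with n hn h2
    obtain ⟨hcard, -, hratio⟩ := hn
    have hn0 : (0 : ℝ) < n := by exact_mod_cast (by omega : 0 < n)
    have hle : ∀ i, (hH n).eigenvalues i ≤ lmax n := fun i => (hlmax n h2).2 ⟨i, rfl⟩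
    have hge : ∀ i, 0 < (hH n).eigenvalues i → lmin n ≤ (hH n).eigenvalues i :=
      fun i hi => (hlmin n h2).2 ⟨hi, i, rfl⟩
    have hmin : 0 < lmin n := (hlmin n h2).1.1
    have hmax : 1 ≤ n * lmax n := by
      rw [← hsum n h2]
      refine (Finset.sum_le_sum fun i _ => hle i).trans ?_
      simp
    have hcard_mul :
        (Nat.card {i : Fin n // 0 < (hH n).eigenvalues i} : ℝ) * lmin n ≤ 1 := by
      rw [← hsum n h2, Nat.card_eq_fintype_card, Fintype.card_subtype, ← nsmul_eq_mul]
      refine (Finset.card_nsmul_le_sum _ (hH n).eigenvalues _ fun i hi =>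
        hge i (Finset.mem_filter.1 hi).2).trans ?_
      exact Finset.sum_le_sum_of_subset_of_nonneg (Finset.filter_subset _ _)
        fun i _ _ => hnn n h2 i
    refine ⟨h2, fun i hi => ?_, fun i => ?_⟩
    · calc β ≤ β * (n * lmax n) := le_mul_of_one_le_right hβ.le hmax
        _ = n * (β * lmax n) := by ring
        _ ≤ n * (hH n).eigenvalues i := by
          gcongr
          exact hratio.trans (hge i hi)
    · rw [inv_eq_one_div, le_div_iff₀' (mul_pos hα hβ)]
      calc α * β * (n * (hH n).eigenvalues i) ≤ α * β * (n * lmax n) := by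
            gcongr
            exact hle i
        _ = α * n * (β * lmax n) := by ring
        _ ≤ α * n * lmin n := by gcongr
        _ ≤ (Nat.card {i : Fin n // 0 < (hH n).eigenvalues i} : ℝ) * lmin n := by gcongr
        _ ≤ 1 := hcard_mul
  have hentropy : Filter.Tendsto (fun n => H n / Real.log n) Filter.atTop (nhds 1) := by
    refine tendsto_div_log_of_abs_sub_log_le (D := |Real.log β| + |Real.log (α * β)⁻¹|) ?_
    filter_upwards [hbounds] with n ⟨h2, hlow, hupp⟩
    rw [hHdef]
    exact abs_entropy_sub_log_le (by exact_mod_cast (by omega : 0 < n)) hβ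
      (hnn n h2) (hsum n h2) hlow hupp
  have hquad : Filter.Tendsto Q Filter.atTop (nhds 1) := by
    have hsq : Filter.Tendsto (fun n => ∑ i, ((hH n).eigenvalues i) ^ 2) Filter.atTop
        (nhds 0) := by
      refine squeeze_zero' (Filter.Eventually.of_forall fun n =>
        Finset.sum_nonneg fun i _ => sq_nonneg _) ?_
        (tendsto_const_div_atTop_nhds_zero_nat (α * β)⁻¹)
      filter_upwards [hbounds] with n ⟨h2, _, hupp⟩
      have hn0 : (0 : ℝ) < n := by exact_mod_cast (by omega : 0 < n)
      exact sum_sq_le_of_le (hnn n h2) (hsum n h2) fun i => (le_div_iff₀' hn0).2 (hupp i)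
    simpa only [← hQdef, sub_zero] using hsq.const_sub 1
  simpa using hentropy.sub hquad
end

section
/- For each n, let W_n be a symmetric n×n real matrix with nonnegative entries and zero diagonal, not identically zero, with trace-normalized Laplacian eigenvalues λ^{(n)}_1 ≥ … ≥ λ^{(n)}_n ≥ 0 summing to 1; let n_+(n) be the number of strictly positive eigenvalues, λ_max(n) the largest eigenvalue, λ_min(n) the smallest strictly positive eigenvalue, H_n the von Neumann graph entropy, Q_n = 1 − Σ_i (λ^{(n)}_i)², and Ĥ_n = −Q_n · ln λ_max(n). Suppose there exist constants α > 0 and β > 0 such that for all sufficiently large n, n_+(n) ≥ α·n, λ_max(n) < 1, and λ_min(n) ≥ β·λ_max(n). Then the scaled approximation error (H_n − Ĥ_n)/ln n → 0 as n → ∞. -/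
open Finset in
/-- If all positive values of a probability vector `f` lie in `[β * M, M]`, then its entropy differs
from `-(1 - ∑ f²) * log M` by at most `-log β + M * log n`. -/
theorem entropy_sub_quadratic_approx_mem_Icc {ι : Type*} [Fintype ι] (f : ι → ℝ)
    (hf : ∀ i, 0 ≤ f i) (hsum : ∑ i, f i = 1) {M β : ℝ} (hM : ∀ i, f i ≤ M) (hM1 : M < 1)
    (hβ : 0 < β) (hmin : ∀ i, 0 < f i → β * M ≤ f i) :
    (-∑ i, f i * Real.log (f i)) - -(1 - ∑ i, f i ^ 2) * Real.log M ∈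
      Set.Icc 0 (-Real.log β + M * Real.log (Fintype.card ι)) := by
  have h_card : 1 ≤ Fintype.card ι * M := by
    rw [← hsum]
    simpa using sum_le_card_nsmul univ f M fun i _ => hM i
  have hM0 : 0 < M := pos_of_mul_pos_right (one_pos.trans_le h_card) (by positivity)
  have h_logM : Real.log M ≤ 0 := Real.log_nonpos hM0.le hM1.le
  have h_log_card : -Real.log M ≤ Real.log (Fintype.card ι) := by
    have h0 : (Fintype.card ι : ℝ) ≠ 0 := by
      intro h
      rw [h] at h_card
      linarith
    have := Real.log_nonneg h_card
    rw [Real.log_mul h0 hM0.ne'] at this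
    linarith
  have h_sq0 : 0 ≤ ∑ i, f i ^ 2 := sum_nonneg fun i _ => sq_nonneg _
  have h_sq : ∑ i, f i ^ 2 ≤ M := by
    calc ∑ i, f i ^ 2 ≤ ∑ i, f i * M :=
          sum_le_sum fun i _ => by rw [sq]; exact mul_le_mul_of_nonneg_left (hM i) (hf i)
      _ = M := by rw [← sum_mul, hsum, one_mul]
  have h_upper : ∑ i, f i * Real.log (f i) ≤ Real.log M := by
    calc ∑ i, f i * Real.log (f i) ≤ ∑ i, f i * Real.log M := sum_le_sum fun i _ => by
          rcases (hf i).eq_or_lt with h | h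
          · simp [← h]
          · exact mul_le_mul_of_nonneg_left (Real.log_le_log h (hM i)) (hf i)
      _ = Real.log M := by rw [← sum_mul, hsum, one_mul]
  have h_lower : Real.log β + Real.log M ≤ ∑ i, f i * Real.log (f i) := by
    calc Real.log β + Real.log M = ∑ i, f i * Real.log (β * M) := by
          rw [← sum_mul, hsum, one_mul, Real.log_mul hβ.ne' hM0.ne']
      _ ≤ ∑ i, f i * Real.log (f i) := sum_le_sum fun i _ => by
          rcases (hf i).eq_or_lt with h | h
          · simp [← h]
          · exact mul_le_mul_of_nonneg_left
              (Real.log_le_log (mul_pos hβ hM0) (hmin i h)) (hf i)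
  have h_prod : (∑ i, f i ^ 2) * -Real.log M ≤ M * Real.log (Fintype.card ι) :=
    mul_le_mul h_sq h_log_card (by linarith) hM0.le
  have h_prod0 : 0 ≤ (∑ i, f i ^ 2) * -Real.log M := mul_nonneg h_sq0 (by linarith)
  constructor <;> linarith

open Finset in
theorem posSemidef_weighted_laplacian {ι : Type*} [Fintype ι] [DecidableEq ι]
    {W : Matrix ι ι ℝ} (hsymm : W.IsSymm) (hnonneg : ∀ i j, 0 ≤ W i j) :
    (Matrix.diagonal (fun i => ∑ j, W i j) - W).PosSemidef := by
  refine Matrix.PosSemidef.of_dotProduct_mulVec_nonneg ?_ fun x => ?_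
  · have h : W.IsHermitian := by simpa [Matrix.IsHermitian] using hsymm.eq
    exact (Matrix.isHermitian_diagonal _).sub h
  · have h_expand : star x ⬝ᵥ ((Matrix.diagonal (fun i => ∑ j, W i j) - W).mulVec x) =
        ∑ i, ∑ j, W i j * (x i ^ 2 - x i * x j) := by
      simp only [dotProduct, Matrix.sub_mulVec, Matrix.mulVec_diagonal, Pi.sub_apply, star_trivial]
      refine sum_congr rfl fun i _ => ?_
      simp only [Matrix.mulVec, dotProduct]
      rw [mul_sub, sum_mul, mul_sum, mul_sum, ← sum_sub_distrib]
      refine sum_congr rfl fun j _ => ?_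
      ring
    have h_swap : ∑ i, ∑ j, W i j * (x i ^ 2 - x i * x j) =
        ∑ i, ∑ j, W i j * (x j ^ 2 - x i * x j) := by
      rw [sum_comm]
      refine sum_congr rfl fun i _ => sum_congr rfl fun j _ => ?_
      rw [hsymm.apply i j]
      ring
    have h_nonneg : 0 ≤ ∑ i, ∑ j, W i j * (x i - x j) ^ 2 :=
      sum_nonneg fun i _ => sum_nonneg fun j _ => mul_nonneg (hnonneg i j) (sq_nonneg _)
    have h_add : ∑ i, ∑ j, W i j * (x i - x j) ^ 2 =
        ∑ i, ∑ j, W i j * (x i ^ 2 - x i * x j) +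
          ∑ i, ∑ j, W i j * (x j ^ 2 - x i * x j) := by
      simp only [← sum_add_distrib]
      refine sum_congr rfl fun i _ => sum_congr rfl fun j _ => ?_
      ring
    rw [h_expand]
    linarith

open Finset in
theorem trace_weighted_laplacian_pos {ι : Type*} [Fintype ι] [DecidableEq ι]
    {W : Matrix ι ι ℝ} (hnonneg : ∀ i j, 0 ≤ W i j) (hdiag : ∀ i, W i i = 0) (hW : W ≠ 0) :
    0 < (Matrix.diagonal (fun i => ∑ j, W i j) - W).trace := by
  have h_trace : (Matrix.diagonal (fun i => ∑ j, W i j) - W).trace = ∑ i, ∑ j, W i j := by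
    simp [Matrix.trace, hdiag]
  obtain ⟨i, j, hij⟩ : ∃ i j, W i j ≠ 0 := by
    by_contra! h
    exact hW (Matrix.ext h)
  rw [h_trace]
  exact sum_pos' (fun i _ => sum_nonneg fun j _ => hnonneg i j)
    ⟨i, mem_univ i, sum_pos' (fun j _ => hnonneg i j)
      ⟨j, mem_univ j, (hnonneg i j).lt_of_ne' hij⟩⟩

open Finset in
theorem card_pos_mul_le_sum {ι : Type*} [Fintype ι] {f : ι → ℝ} (hf : ∀ i, 0 ≤ f i) {c : ℝ}
    (hc : ∀ i, 0 < f i → c ≤ f i) : (Nat.card {i // 0 < f i} : ℝ) * c ≤ ∑ i, f i := by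
  classical
  rw [Nat.card_eq_fintype_card, Fintype.card_subtype, ← nsmul_eq_mul]
  calc _ ≤ ∑ i with 0 < f i, f i := card_nsmul_le_sum _ _ _ fun i hi => hc i (by simpa using hi)
    _ ≤ ∑ i, f i := sum_le_sum_of_subset_of_nonneg (filter_subset _ _) fun i _ _ => hf i


/-- **Corollary 2 (o(ln n) approximation error of Ĥ).**
For each `n`, let `W n` be the (symmetric, nonnegative, zero-diagonal, nonzero)
weight matrix of a graph on `n` vertices, with trace-normalized Laplacian `LN n`,
von Neumann graph entropy `H n`, quadratic approximation `Q n`, largest eigenvalue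
`lmax n`, smallest strictly positive eigenvalue `lmin n`, `n_+` strictly positive
eigenvalues, and FINGER approximation `Ĥ n = -(Q n) * ln (lmax n)`. If there exist
constants `α, β > 0` such that for all sufficiently large `n`, `n_+ ≥ α·n`,
`lmax n < 1` and `lmin n ≥ β·lmax n`, then the scaled approximation error
`(H n - Ĥ n) / ln n → 0` as `n → ∞`. -/
theorem finger_hHat_approximation_error
    (W : ∀ n : ℕ, Matrix (Fin n) (Fin n) ℝ)
    (hsymm : ∀ n, 2 ≤ n → (W n).IsSymm)
    (hnonneg : ∀ n, 2 ≤ n → ∀ i j, 0 ≤ W n i j)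
    (hdiag : ∀ n, 2 ≤ n → ∀ i, W n i i = 0)
    (hW : ∀ n, 2 ≤ n → W n ≠ 0)
    (LN : ∀ n : ℕ, Matrix (Fin n) (Fin n) ℝ)
    (hLN : ∀ n, LN n = (Matrix.diagonal (fun i => ∑ j, W n i j) - W n).trace⁻¹ •
        (Matrix.diagonal (fun i => ∑ j, W n i j) - W n))
    (hH : ∀ n, (LN n).IsHermitian)
    (lmax lmin : ℕ → ℝ)
    (hlmax : ∀ n, 2 ≤ n → IsGreatest {x | ∃ i, (hH n).eigenvalues i = x} (lmax n))
    (hlmin : ∀ n, 2 ≤ n → IsLeast {x | 0 < x ∧ ∃ i, (hH n).eigenvalues i = x} (lmin n))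
    (H Q : ℕ → ℝ)
    (hHdef : ∀ n, H n = -∑ i, (hH n).eigenvalues i * Real.log ((hH n).eigenvalues i))
    (hQdef : ∀ n, Q n = 1 - ∑ i, ((hH n).eigenvalues i) ^ 2)
    (Hhat : ℕ → ℝ)
    (hHhat : ∀ n, Hhat n = -(Q n) * Real.log (lmax n))
    (α β : ℝ) (hα : 0 < α) (hβ : 0 < β)
    (hbig : ∀ᶠ n in Filter.atTop,
      α * n ≤ (Nat.card {i : Fin n // 0 < (hH n).eigenvalues i} : ℝ)
      ∧ lmax n < 1 ∧ β * lmax n ≤ lmin n) :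
    Filter.Tendsto (fun n => (H n - Hhat n) / Real.log n) Filter.atTop (nhds 0) := by
  have h_bound : ∀ᶠ n : ℕ in Filter.atTop, 0 ≤ (H n - Hhat n) / Real.log n ∧
      (H n - Hhat n) / Real.log n ≤ -Real.log β / Real.log n + (α * β)⁻¹ / n := by
    filter_upwards [hbig, Filter.eventually_ge_atTop 2] with n ⟨h_card, h_lt, h_ratio⟩ hn
    have h_trace := trace_weighted_laplacian_pos (hnonneg n hn) (hdiag n hn) (hW n hn)
    have h_nonneg : ∀ i, 0 ≤ (hH n).eigenvalues i := by
      have h_psd : (LN n).PosSemidef := by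
        rw [hLN n]
        exact (posSemidef_weighted_laplacian (hsymm n hn) (hnonneg n hn)).smul
          (inv_nonneg.2 h_trace.le)
      exact h_psd.eigenvalues_nonneg
    have h_sum : ∑ i, (hH n).eigenvalues i = 1 := by
      have h := (hH n).trace_eq_sum_eigenvalues
      have h_one : (LN n).trace = 1 := by
        rw [hLN n, Matrix.trace_smul, smul_eq_mul, inv_mul_cancel₀ h_trace.ne']
      rw [h_one] at h
      simpa using h.symm
    have h_le : ∀ i, (hH n).eigenvalues i ≤ lmax n := fun i => (hlmax n hn).2 ⟨i, rfl⟩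
    have h_min : ∀ i, 0 < (hH n).eigenvalues i → β * lmax n ≤ (hH n).eigenvalues i :=
      fun i hi => h_ratio.trans ((hlmin n hn).2 ⟨hi, i, rfl⟩)
    have h_max0 : 0 ≤ lmax n := (h_nonneg ⟨0, by lia⟩).trans (h_le _)
    have h_n : (2 : ℝ) ≤ n := by exact_mod_cast hn
    have h_log : 0 < Real.log n := Real.log_pos (by linarith)
    have h_max : lmax n ≤ (α * β)⁻¹ / n := by
      have h := card_pos_mul_le_sum h_nonneg h_min
      rw [h_sum] at h
      have h' := (mul_le_mul_of_nonneg_right h_card (mul_nonneg hβ.le h_max0)).trans h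
      rw [inv_eq_one_div, div_div, le_div_iff₀ (by positivity)]
      linarith
    have h_err := entropy_sub_quadratic_approx_mem_Icc _ h_nonneg h_sum h_le h_lt hβ h_min
    rw [← hHdef, ← hQdef, ← hHhat, Fintype.card_fin] at h_err
    refine ⟨div_nonneg h_err.1 h_log.le, ?_⟩
    calc (H n - Hhat n) / Real.log n
        ≤ (-Real.log β + lmax n * Real.log n) / Real.log n :=
          div_le_div_of_nonneg_right h_err.2 h_log.le
      _ = -Real.log β / Real.log n + lmax n := by field_simp
      _ ≤ _ := by gcongr
  refine tendsto_of_tendsto_of_tendsto_of_le_of_le' tendsto_const_nhds ?_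
    (h_bound.mono fun n h => h.1) (h_bound.mono fun n h => h.2)
  have h_log := (Real.tendsto_log_atTop.comp tendsto_natCast_atTop_atTop).const_div_atTop
    (-Real.log β)
  simpa using h_log.add (tendsto_const_div_atTop_nhds_zero_nat (α * β)⁻¹)
end

section
/- Let W be a symmetric n×n real matrix with nonnegative entries and zero diagonal, not identically zero, with maximal nodal strength s_max, total strength S > 0, c = 1/S, trace-normalized Laplacian eigenvalues λ_1 ≥ … ≥ λ_n ≥ 0 summing to 1, largest eigenvalue λ_max, smallest strictly positive eigenvalue λ_min, von Neumann graph entropy H, quadratic approximation Q = 1 − Σ_i λ_i², and approximations Ĥ = −Q ln λ_max and H̃ = −Q ln(2·c·s_max). If λ_max < 1, then H̃ ≤ Ĥ ≤ H. -/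
open Finset in
/-- Gershgorin bounds for the eigenvalues of a scaled weighted graph Laplacian. -/
theorem laplacian_eigenvalue_bounds {ι : Type*} [Fintype ι] [DecidableEq ι]
    {W : Matrix ι ι ℝ} (hnonneg : ∀ i j, 0 ≤ W i j) (hdiag : ∀ i, W i i = 0)
    {s : ι → ℝ} (hs : ∀ i, s i = ∑ j, W i j) {c : ℝ} (hc : 0 ≤ c)
    {A : Matrix ι ι ℝ} (hA : A = c • (Matrix.diagonal s - W))
    {μ : ℝ} (hμ : Module.End.HasEigenvalue (Matrix.toLin' A) μ) :
    0 ≤ μ ∧ ∃ k, μ ≤ 2 * c * s k := by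
  obtain ⟨k, hk⟩ := eigenvalue_mem_ball hμ
  have hoff : ∑ j ∈ univ.erase k, ‖A k j‖ = c * s k := by
    rw [hs, ← add_sum_erase univ (fun j ↦ W k j) (mem_univ k), hdiag, zero_add, mul_sum]
    refine sum_congr rfl fun j hj ↦ ?_
    have hkj : k ≠ j := (ne_of_mem_erase hj).symm
    simp [hA, Matrix.diagonal_apply_ne _ hkj, abs_of_nonneg, hc, hnonneg]
  have hkk : A k k = c * s k := by simp [hA, hdiag]
  rw [hoff, hkk, Metric.mem_closedBall, Real.dist_eq, abs_le] at hk
  exact ⟨by linarith, k, by linarith⟩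

theorem Matrix.IsHermitian.hasEigenvalue_eigenvalues {ι : Type*} [Fintype ι] [DecidableEq ι]
    {A : Matrix ι ι ℝ} (hA : A.IsHermitian) (i : ι) :
    Module.End.HasEigenvalue (Matrix.toLin' A) (hA.eigenvalues i) := by
  rw [Module.End.hasEigenvalue_iff_mem_spectrum, Matrix.spectrum_toLin']
  exact hA.eigenvalues_mem_spectrum_real i

/-- For a probability vector bounded by `m`, the Shannon entropy is at least `-log m`. -/
theorem neg_log_le_entropy {ι : Type*} [Fintype ι] {p : ι → ℝ} (hp : ∀ i, 0 ≤ p i)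
    (hsum : ∑ i, p i = 1) {m : ℝ} (hm : ∀ i, p i ≤ m) :
    -Real.log m ≤ -∑ i, p i * Real.log (p i) := by
  rw [neg_le_neg_iff]
  calc ∑ i, p i * Real.log (p i) ≤ ∑ i, p i * Real.log m := by
        refine Finset.sum_le_sum fun i _ ↦ ?_
        rcases (hp i).eq_or_lt with h | h
        · simp [← h]
        · exact mul_le_mul_of_nonneg_left (Real.log_le_log h (hm i)) h.le
    _ = Real.log m := by rw [← Finset.sum_mul, hsum, one_mul]


/-- **Entropy inequality H̃ ≤ Ĥ ≤ H.**
For a weighted undirected graph with symmetric, nonnegative, zero-diagonal,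
nonzero weight matrix `W`, nodal strengths `s`, maximal nodal strength `smax`,
total strength `S > 0`, `c = 1/S`, trace-normalized Laplacian `LN = c • (diag s - W)`
with largest eigenvalue `lmax`, von Neumann graph entropy `H`, quadratic
approximation `Q = 1 - ∑ λ²`, and approximations `Ĥ = -Q ln lmax` and
`H̃ = -Q ln (2 c smax)`: if `lmax < 1`, then `H̃ ≤ Ĥ ≤ H`. -/
theorem finger_entropy_inequality {n : ℕ}
    (W : Matrix (Fin n) (Fin n) ℝ)
    (hsymm : W.IsSymm)
    (hnonneg : ∀ i j, 0 ≤ W i j)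
    (hdiag : ∀ i, W i i = 0)
    (hW : W ≠ 0)
    (s : Fin n → ℝ) (hs : ∀ i, s i = ∑ j, W i j)
    (smax : ℝ) (hsmax : IsGreatest {x | ∃ i, s i = x} smax)
    (S : ℝ) (hS : S = ∑ i, s i) (hSpos : 0 < S)
    (c : ℝ) (hc : c = 1 / S)
    (LN : Matrix (Fin n) (Fin n) ℝ)
    (hLN : LN = c • (Matrix.diagonal s - W))
    (hH : LN.IsHermitian)
    (lmax : ℝ)
    (hlmax : IsGreatest {x | ∃ i, hH.eigenvalues i = x} lmax)
    (H Q Hhat Htilde : ℝ)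
    (hHdef : H = -∑ i, hH.eigenvalues i * Real.log (hH.eigenvalues i))
    (hQdef : Q = 1 - ∑ i, (hH.eigenvalues i) ^ 2)
    (hHhat : Hhat = -Q * Real.log lmax)
    (hHtilde : Htilde = -Q * Real.log (2 * c * smax))
    (hlt : lmax < 1) :
    Htilde ≤ Hhat ∧ Hhat ≤ H := by
  have hc0 : 0 < c := by rw [hc]; positivity
  have hbd i := laplacian_eigenvalue_bounds hnonneg hdiag hs hc0.le hLN
    (hH.hasEigenvalue_eigenvalues i)
  have hsum : ∑ i, hH.eigenvalues i = 1 := by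
    have htr : LN.trace = ∑ i, hH.eigenvalues i := by simpa using hH.trace_eq_sum_eigenvalues
    rw [← htr, hLN, Matrix.trace_smul]
    simp [Matrix.trace, hdiag, ← hS, hc, hSpos.ne']
  have hle i : hH.eigenvalues i ≤ lmax := hlmax.2 ⟨i, rfl⟩
  have hpos : 0 < lmax := by
    by_contra! h
    have : ∑ i, hH.eigenvalues i ≤ 0 := Finset.sum_nonpos fun i _ ↦ (hle i).trans h
    linarith
  have hmax : lmax ≤ 2 * c * smax := by
    obtain ⟨i, rfl⟩ := hlmax.1
    obtain ⟨k, hk⟩ := (hbd i).2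
    exact hk.trans (mul_le_mul_of_nonneg_left (hsmax.2 ⟨k, rfl⟩) (by positivity))
  have hQ1 : Q ≤ 1 := by
    rw [hQdef]
    exact sub_le_self _ (Finset.sum_nonneg fun i _ ↦ sq_nonneg _)
  have hQ0 : 0 ≤ Q := by
    rw [hQdef, sub_nonneg, ← hsum]
    refine Finset.sum_le_sum fun i _ ↦ ?_
    nlinarith [(hbd i).1, hle i]
  have hlog : Real.log lmax ≤ 0 := Real.log_nonpos hpos.le hlt.le
  constructor
  · rw [hHtilde, hHhat]
    exact mul_le_mul_of_nonpos_left (Real.log_le_log hpos hmax) (neg_nonpos.2 hQ0)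
  · rw [hHhat, hHdef]
    refine le_trans ?_ (neg_log_le_entropy (fun i ↦ (hbd i).1) hsum hle)
    nlinarith
end

section
/- Let W be a symmetric n×n real matrix (n ≥ 2) with nonnegative entries and zero diagonal, not identically zero, with nodal strengths s_i = Σ_j W_{ij} and maximal nodal strength s_max = max_i s_i. Let μ_max be the largest eigenvalue of the combinatorial Laplacian L = diag(s) − W. Then (n/(n−1))·s_max ≤ μ_max ≤ 2·s_max. -/
open Matrix

namespace Matrix

/-- The Rayleigh quotient of a real symmetric matrix is at most any upper bound of its
eigenvalues. -/
theorem IsHermitian.dotProduct_mulVec_le {ι : Type*} [Fintype ι] [DecidableEq ι]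
    {A : Matrix ι ι ℝ} (hA : A.IsHermitian) {c : ℝ} (hc : ∀ i, hA.eigenvalues i ≤ c)
    (x : ι → ℝ) : x ⬝ᵥ A *ᵥ x ≤ c * (x ⬝ᵥ x) := by
  have hpsd : (c • (1 : Matrix ι ι ℝ) - A).PosSemidef := by
    have hdiag : (diagonal fun i => c - hA.eigenvalues i).PosSemidef :=
      PosSemidef.diagonal fun i => sub_nonneg.2 (hc i)
    have h := hdiag.mul_mul_conjTranspose_same (hA.eigenvectorUnitary : Matrix ι ι ℝ)
    have hU : (hA.eigenvectorUnitary : Matrix ι ι ℝ) *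
        (hA.eigenvectorUnitary : Matrix ι ι ℝ)ᴴ = 1 :=
      Unitary.coe_mul_star_self hA.eigenvectorUnitary
    have hspec := hA.spectral_theorem
    rw [Unitary.conjStarAlgAut_apply] at hspec
    have hsplit : (diagonal fun i => c - hA.eigenvalues i) =
        c • (1 : Matrix ι ι ℝ) - diagonal (RCLike.ofReal ∘ hA.eigenvalues) := by
      ext i j
      by_cases hij : i = j <;> simp [hij]
    rw [hsplit, mul_sub, sub_mul, mul_smul_comm, smul_mul_assoc, mul_one, hU] at h
    convert h using 2
    exact hspec
  have h := hpsd.dotProduct_mulVec_nonneg x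
  simpa [sub_mulVec, smul_mulVec, dotProduct_sub] using h

/-- An eigenvalue of a Hermitian matrix lies in one of the Gershgorin discs. -/
theorem IsHermitian.exists_abs_eigenvalues_sub_le {ι : Type*} [Fintype ι] [DecidableEq ι]
    {A : Matrix ι ι ℝ} (hA : A.IsHermitian) (i : ι) :
    ∃ k, |hA.eigenvalues i - A k k| ≤ ∑ j ∈ Finset.univ.erase k, |A k j| := by
  have h : Module.End.HasEigenvalue (Matrix.toLin' A) (hA.eigenvalues i) := by
    rw [Module.End.hasEigenvalue_iff_mem_spectrum, spectrum_toLin']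
    exact hA.eigenvalues_mem_spectrum_real i
  simpa [Metric.mem_closedBall, Real.dist_eq] using eigenvalue_mem_ball h

end Matrix

/-- **Fiedler and Anderson–Morley bounds on the largest Laplacian eigenvalue.**
For a weighted undirected graph on `n ≥ 2` vertices with symmetric, nonnegative,
zero-diagonal, nonzero weight matrix `W`, nodal strengths `s i = ∑ j, W i j`,
maximal nodal strength `smax`, and largest eigenvalue `μmax` of the combinatorial
Laplacian `L = diag s - W`, we have `(n/(n-1)) * smax ≤ μmax ≤ 2 * smax`. -/
theorem fiedler_anderson_morley_bounds {n : ℕ} (hn : 2 ≤ n)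
    (W : Matrix (Fin n) (Fin n) ℝ)
    (hsymm : W.IsSymm)
    (hnonneg : ∀ i j, 0 ≤ W i j)
    (hdiag : ∀ i, W i i = 0)
    (hW : W ≠ 0)
    (s : Fin n → ℝ) (hs : ∀ i, s i = ∑ j, W i j)
    (smax : ℝ) (hsmax : IsGreatest {x | ∃ i, s i = x} smax)
    (hL : (Matrix.diagonal s - W).IsHermitian)
    (μmax : ℝ) (hμmax : IsGreatest {x | ∃ i, hL.eigenvalues i = x} μmax) :
    ((n : ℝ) / ((n : ℝ) - 1)) * smax ≤ μmax ∧ μmax ≤ 2 * smax := by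
  have hentry : ∀ k, (Matrix.diagonal s - W) k k = s k := fun k => by simp [hdiag]
  constructor
  · obtain ⟨i, hi⟩ := hsmax.1
    have hn' : (0 : ℝ) < (n : ℝ) - 1 := by
      have : (2 : ℝ) ≤ n := by exact_mod_cast hn
      linarith
    have hbound := hL.dotProduct_mulVec_le (fun j => hμmax.2 ⟨j, rfl⟩)
      ((n : ℝ) • Pi.single i 1 - 1)
    have hone : (Matrix.diagonal s - W) *ᵥ 1 = 0 := by
      ext k
      simp [mulVec, dotProduct, diagonal_apply, hs]
    have hone' : (1 : Fin n → ℝ) ⬝ᵥ (Matrix.diagonal s - W).col i = 0 := by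
      have hT : (Matrix.diagonal s - W)ᵀ = Matrix.diagonal s - W := by
        simp [hsymm.eq]
      have h := congrFun hone i
      rw [← hT] at h
      rw [dotProduct_comm]
      exact h
    have hquad : ((n : ℝ) • Pi.single i 1 - 1) ⬝ᵥ
        (Matrix.diagonal s - W) *ᵥ ((n : ℝ) • Pi.single i 1 - 1) = (n : ℝ) ^ 2 * s i := by
      rw [mulVec_sub, hone, sub_zero, mulVec_smul, mulVec_single_one, dotProduct_smul,
        sub_dotProduct, hone', smul_dotProduct, single_one_dotProduct, col_apply, hentry]
      simp only [smul_eq_mul]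
      ring
    have hnorm : ((n : ℝ) • Pi.single i 1 - 1 : Fin n → ℝ) ⬝ᵥ ((n : ℝ) • Pi.single i 1 - 1) =
        (n : ℝ) * (n - 1) := by
      simp [sub_dotProduct, dotProduct_sub, mul_sub]
    rw [hquad, hnorm, hi] at hbound
    rw [div_mul_eq_mul_div, div_le_iff₀ hn']
    have hnpos : (0 : ℝ) < n := by linarith
    exact le_of_mul_le_mul_left (by linarith) hnpos
  · obtain ⟨i, hi⟩ := hμmax.1
    obtain ⟨k, hk⟩ := hL.exists_abs_eigenvalues_sub_le i
    have hrow : ∑ j ∈ Finset.univ.erase k, |(Matrix.diagonal s - W) k j| = s k := by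
      rw [hs, ← Finset.add_sum_erase _ _ (Finset.mem_univ k), hdiag, zero_add]
      refine Finset.sum_congr rfl fun j hj => ?_
      simp [Matrix.diagonal_apply_ne' _ (Finset.ne_of_mem_erase hj), abs_of_nonneg (hnonneg k j)]
    rw [hrow, hentry, hi] at hk
    linarith [le_of_abs_le hk, hsmax.2 ⟨k, rfl⟩]
end

section
/- For each n, let W_n and W'_n be symmetric n×n real matrices with nonnegative entries and zero diagonal, not identically zero, and let W̄_n = (W_n + W'_n)/2 be their averaged graph. For a weight matrix V, write H(V) for the von Neumann graph entropy of its trace-normalized Laplacian, Q(V) = 1 − Σ_i λ_i(V)² for the quadratic approximation, λ_max(V) for the largest normalized-Laplacian eigenvalue, and Ĥ(V) = −Q(V) ln λ_max(V). Define the Jensen–Shannon divergence JSdiv_n = H(W̄_n) − (H(W_n) + H(W'_n))/2 and its FINGER approximation JSdiv^F_n = Ĥ(W̄_n) − (Ĥ(W_n) + Ĥ(W'_n))/2. Suppose there exist constants α > 0 and β > 0 such that for all sufficiently large n, each of the three graphs W_n, W'_n, W̄_n has at least α·n strictly positive normalized-Laplacian eigenvalues, largest normalized-Laplacian eigenvalue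 strictly less than 1, and smallest strictly positive normalized-Laplacian eigenvalue at least β times its largest one. Then (JSdiv_n − JSdiv^F_n)/ln n → 0 as n → ∞; consequently |√(JSdiv_n) − √(max(JSdiv^F_n, 0))| = o(√(ln n)), i.e., the FINGER Jensen–Shannon distance is asymptotically equivalent to the exact one after scaling by √(ln n). -/
open Finset in
/-- The quadratic form of a weighted graph Laplacian is half a weighted sum of squared differences. -/
lemma two_mul_laplacian_quadratic_form {ι : Type*} [Fintype ι] [DecidableEq ι]
    (V : Matrix ι ι ℝ) (hs : V.IsSymm) (x : ι → ℝ) :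
    2 * (x ⬝ᵥ ((Matrix.diagonal (fun i => ∑ j, V i j) - V).mulVec x)) =
      ∑ i, ∑ j, V i j * (x i - x j) ^ 2 := by
  have key : x ⬝ᵥ ((Matrix.diagonal (fun i => ∑ j, V i j) - V).mulVec x) =
      ∑ i, ∑ j, V i j * (x i ^ 2 - x i * x j) := by
    rw [Matrix.sub_mulVec, dotProduct]
    refine sum_congr rfl fun i _ => ?_
    rw [Pi.sub_apply, Matrix.mulVec_diagonal, Matrix.mulVec, dotProduct, sum_mul,
      ← sum_sub_distrib, mul_sum]
    exact sum_congr rfl fun j _ => by ring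
  have swap : ∑ i, ∑ j, V i j * (x i ^ 2 - x i * x j) =
      ∑ i, ∑ j, V i j * (x j ^ 2 - x i * x j) := by
    rw [sum_comm]
    refine sum_congr rfl fun i _ => sum_congr rfl fun j _ => ?_
    rw [hs.apply]
    ring
  rw [two_mul, key]
  nth_rewrite 2 [swap]
  rw [← sum_add_distrib]
  refine sum_congr rfl fun i _ => ?_
  rw [← sum_add_distrib]
  exact sum_congr rfl fun j _ => by ring

/-- The Laplacian of a symmetric nonnegative weight matrix is positive semidefinite. -/
lemma posSemidef_laplacian {ι : Type*} [Fintype ι] [DecidableEq ι]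
    (V : Matrix ι ι ℝ) (hs : V.IsSymm) (hn : ∀ i j, 0 ≤ V i j) :
    (Matrix.diagonal (fun i => ∑ j, V i j) - V).PosSemidef := by
  refine Matrix.PosSemidef.of_dotProduct_mulVec_nonneg ?_ fun x => ?_
  · rw [Matrix.IsHermitian, Matrix.conjTranspose_eq_transpose_of_trivial, Matrix.transpose_sub,
      Matrix.diagonal_transpose, hs.eq]
  · have h := two_mul_laplacian_quadratic_form V hs x
    have h' : 0 ≤ ∑ i, ∑ j, V i j * (x i - x j) ^ 2 :=
      Finset.sum_nonneg fun i _ => Finset.sum_nonneg fun j _ => mul_nonneg (hn i j) (sq_nonneg _)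
    rw [star_trivial]
    linarith

/-- The Laplacian of a nonzero nonnegative weight matrix with zero diagonal has positive trace. -/
lemma trace_laplacian_pos_s13 {ι : Type*} [Fintype ι] [DecidableEq ι]
    (V : Matrix ι ι ℝ) (hn : ∀ i j, 0 ≤ V i j) (hd : ∀ i, V i i = 0) (hne : V ≠ 0) :
    0 < (Matrix.diagonal (fun i => ∑ j, V i j) - V).trace := by
  have htr : (Matrix.diagonal (fun i => ∑ j, V i j) - V).trace = ∑ i, ∑ j, V i j := by
    simp [Matrix.trace, hd]
  rw [htr]
  obtain ⟨i, j, hij⟩ : ∃ i j, V i j ≠ 0 := by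
    by_contra! h
    exact hne (Matrix.ext h)
  have hpos : 0 < V i j := lt_of_le_of_ne (hn i j) hij.symm
  calc 0 < V i j := hpos
    _ ≤ ∑ j, V i j := Finset.single_le_sum (fun k _ => hn i k) (Finset.mem_univ j)
    _ ≤ ∑ i, ∑ j, V i j :=
      Finset.single_le_sum (f := fun i => ∑ j, V i j)
        (fun k _ => Finset.sum_nonneg fun l _ => hn k l) (Finset.mem_univ i)

/-- The eigenvalues of a trace-normalized Laplacian form a probability vector. -/
lemma eigenvalues_normalized_laplacian {ι : Type*} [Fintype ι] [DecidableEq ι]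
    (V : Matrix ι ι ℝ) (hs : V.IsSymm) (hn : ∀ i j, 0 ≤ V i j) (hd : ∀ i, V i i = 0)
    (hne : V ≠ 0) {N : Matrix ι ι ℝ}
    (hN : N = (Matrix.diagonal (fun i => ∑ j, V i j) - V).trace⁻¹ •
      (Matrix.diagonal (fun i => ∑ j, V i j) - V)) (h : N.IsHermitian) :
    (∀ i, 0 ≤ h.eigenvalues i) ∧ ∑ i, h.eigenvalues i = 1 := by
  have htr := trace_laplacian_pos_s13 V hn hd hne
  have hpsd : N.PosSemidef := hN ▸ (posSemidef_laplacian V hs hn).smul (inv_nonneg.2 htr.le)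
  refine ⟨fun i => hpsd.eigenvalues_nonneg i, ?_⟩
  have ht : N.trace = ∑ i, h.eigenvalues i := by simpa using h.trace_eq_sum_eigenvalues
  rw [← ht, hN, Matrix.trace_smul, smul_eq_mul, inv_mul_cancel₀ htr.ne']

/-- For a probability vector whose positive entries lie in `[β M, M]`, where `M` is its largest
entry, the entropy and its FINGER approximation differ by at most a constant depending on `β`. -/
lemma abs_entropy_sub_finger_le {ι : Type*} [Fintype ι] {p : ι → ℝ} {M m β : ℝ}
    (hp : ∀ i, 0 ≤ p i) (hsum : ∑ i, p i = 1)
    (hM : IsGreatest {x | ∃ i, p i = x} M) (hm : IsLeast {x | 0 < x ∧ ∃ i, p i = x} m)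
    (hβ : 0 < β) (hβm : β * M ≤ m) :
    |(-∑ i, p i * Real.log (p i)) - -(1 - ∑ i, p i ^ 2) * Real.log M| ≤ 1 - Real.log β := by
  have hle : ∀ i, p i ≤ M := fun i => hM.2 ⟨i, rfl⟩
  obtain ⟨hm0, i₀, hi₀⟩ := hm.1
  have hmM : m ≤ M := hi₀ ▸ hle i₀
  have hM0 : 0 < M := hm0.trans_le hmM
  have hM1 : M ≤ 1 := by
    obtain ⟨k, hk⟩ := hM.1
    rw [← hk, ← hsum]
    exact Finset.single_le_sum (fun i _ => hp i) (Finset.mem_univ k)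
  have hβ1 : β ≤ 1 := by
    by_contra! h
    nlinarith
  have hlogβ : Real.log β ≤ 0 := Real.log_nonpos hβ.le hβ1
  have hlogM : Real.log M ≤ 0 := Real.log_nonpos hM0.le hM1
  have upper : ∑ i, p i * Real.log (p i) ≤ Real.log M := by
    calc ∑ i, p i * Real.log (p i) ≤ ∑ i, p i * Real.log M := by
          refine Finset.sum_le_sum fun i _ => ?_
          rcases (hp i).eq_or_lt with h | h
          · simp [← h]
          · exact mul_le_mul_of_nonneg_left (Real.log_le_log h (hle i)) h.le
      _ = Real.log M := by rw [← Finset.sum_mul, hsum, one_mul]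
  have lower : Real.log β + Real.log M ≤ ∑ i, p i * Real.log (p i) := by
    calc Real.log β + Real.log M = ∑ i, p i * (Real.log β + Real.log M) := by
          rw [← Finset.sum_mul, hsum, one_mul]
      _ ≤ ∑ i, p i * Real.log (p i) := by
          refine Finset.sum_le_sum fun i _ => ?_
          rcases (hp i).eq_or_lt with h | h
          · simp [← h]
          · refine mul_le_mul_of_nonneg_left ?_ h.le
            rw [← Real.log_mul hβ.ne' hM0.ne']
            exact Real.log_le_log (mul_pos hβ hM0) (hβm.trans (hm.2 ⟨h, i, rfl⟩))
  have hsq0 : 0 ≤ ∑ i, p i ^ 2 := Finset.sum_nonneg fun i _ => sq_nonneg _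
  have hsq : ∑ i, p i ^ 2 ≤ M := by
    calc ∑ i, p i ^ 2 ≤ ∑ i, p i * M := Finset.sum_le_sum fun i _ => by
          rw [sq]
          exact mul_le_mul_of_nonneg_left (hle i) (hp i)
      _ = M := by rw [← Finset.sum_mul, hsum, one_mul]
  have hMlog : -1 ≤ M * Real.log M := by
    have h := mul_le_mul_of_nonneg_left (Real.one_sub_inv_le_log_of_pos hM0) hM0.le
    rw [mul_sub, mul_one, mul_inv_cancel₀ hM0.ne'] at h
    linarith
  have herr : -1 ≤ (∑ i, p i ^ 2) * Real.log M :=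
    hMlog.trans (mul_le_mul_of_nonpos_right hsq hlogM)
  have herr0 : (∑ i, p i ^ 2) * Real.log M ≤ 0 := mul_nonpos_of_nonneg_of_nonpos hsq0 hlogM
  rw [abs_le]
  constructor <;> linarith

/-- The square root is `1/2`-Hölder, also after truncating negative arguments. -/
lemma abs_sqrt_sub_sqrt_max_le (a b : ℝ) :
    |Real.sqrt a - Real.sqrt (max b 0)| ≤ Real.sqrt |a - b| := by
  have aux : ∀ u v : ℝ, Real.sqrt u ≤ Real.sqrt v + Real.sqrt |u - v| := fun u v => by
    rw [Real.sqrt_le_left (by positivity)]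
    rcases le_total 0 v with hv | hv
    · nlinarith [Real.sq_sqrt hv, Real.sq_sqrt (abs_nonneg (u - v)), le_abs_self (u - v),
        mul_nonneg (Real.sqrt_nonneg v) (Real.sqrt_nonneg |u - v|)]
    · rw [Real.sqrt_eq_zero_of_nonpos hv, zero_add, Real.sq_sqrt (abs_nonneg _)]
      linarith [le_abs_self (u - v)]
  have hb : Real.sqrt (max b 0) = Real.sqrt b := by
    rcases le_total 0 b with h | h
    · rw [max_eq_left h]
    · rw [max_eq_right h, Real.sqrt_zero, Real.sqrt_eq_zero_of_nonpos h]
  rw [hb, abs_le]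
  have h1 := aux a b
  have h2 := aux b a
  rw [abs_sub_comm] at h2
  constructor <;> linarith


/-- **Asymptotic equivalence of the FINGER Jensen–Shannon distance.**
For each `n`, let `W n` and `W' n` be symmetric, nonnegative, zero-diagonal,
nonzero weight matrices on `n` vertices and `Wbar n = (W n + W' n)/2` their
averaged graph. For a weight matrix `V`, `H(V)` is the von Neumann graph entropy
of the trace-normalized Laplacian, `Q(V) = 1 - ∑ λ²`, `λmax(V)` its largest
eigenvalue, and `Ĥ(V) = -Q(V) ln λmax(V)`. With
`JSdiv n = H(Wbar n) - (H(W n) + H(W' n))/2` and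
`JSdivF n = Ĥ(Wbar n) - (Ĥ(W n) + Ĥ(W' n))/2`, if there exist constants
`α, β > 0` such that for all sufficiently large `n` each of the three graphs has
at least `α·n` strictly positive normalized-Laplacian eigenvalues, largest
normalized-Laplacian eigenvalue `< 1`, and smallest strictly positive
normalized-Laplacian eigenvalue `≥ β` times its largest one, then
`(JSdiv n - JSdivF n)/ln n → 0`, and consequently
`|√(JSdiv n) - √(max (JSdivF n) 0)| = o(√(ln n))`. -/
theorem finger_js_distance_asymptotic_equivalence
    (W W' Wbar : ∀ n : ℕ, Matrix (Fin n) (Fin n) ℝ)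
    (hWbar : ∀ n, Wbar n = (1 / 2 : ℝ) • (W n + W' n))
    (hsymm : ∀ n, 2 ≤ n → (W n).IsSymm) (hsymm' : ∀ n, 2 ≤ n → (W' n).IsSymm)
    (hnonneg : ∀ n, 2 ≤ n → ∀ i j, 0 ≤ W n i j)
    (hnonneg' : ∀ n, 2 ≤ n → ∀ i j, 0 ≤ W' n i j)
    (hdiag : ∀ n, 2 ≤ n → ∀ i, W n i i = 0)
    (hdiag' : ∀ n, 2 ≤ n → ∀ i, W' n i i = 0)
    (hne : ∀ n, 2 ≤ n → W n ≠ 0) (hne' : ∀ n, 2 ≤ n → W' n ≠ 0)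
    (LN : ∀ n : ℕ, Matrix (Fin n) (Fin n) ℝ → Matrix (Fin n) (Fin n) ℝ)
    (hLN : ∀ n (V : Matrix (Fin n) (Fin n) ℝ),
      LN n V = (Matrix.diagonal (fun i => ∑ j, V i j) - V).trace⁻¹ •
        (Matrix.diagonal (fun i => ∑ j, V i j) - V))
    (h1 : ∀ n, (LN n (W n)).IsHermitian)
    (h2 : ∀ n, (LN n (W' n)).IsHermitian)
    (h3 : ∀ n, (LN n (Wbar n)).IsHermitian)
    (lmax1 lmax2 lmax3 lmin1 lmin2 lmin3 : ℕ → ℝ)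
    (hlmax1 : ∀ n, 2 ≤ n → IsGreatest {x | ∃ i, (h1 n).eigenvalues i = x} (lmax1 n))
    (hlmax2 : ∀ n, 2 ≤ n → IsGreatest {x | ∃ i, (h2 n).eigenvalues i = x} (lmax2 n))
    (hlmax3 : ∀ n, 2 ≤ n → IsGreatest {x | ∃ i, (h3 n).eigenvalues i = x} (lmax3 n))
    (hlmin1 : ∀ n, 2 ≤ n → IsLeast {x | 0 < x ∧ ∃ i, (h1 n).eigenvalues i = x} (lmin1 n))
    (hlmin2 : ∀ n, 2 ≤ n → IsLeast {x | 0 < x ∧ ∃ i, (h2 n).eigenvalues i = x} (lmin2 n))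
    (hlmin3 : ∀ n, 2 ≤ n → IsLeast {x | 0 < x ∧ ∃ i, (h3 n).eigenvalues i = x} (lmin3 n))
    (H1 H2 H3 Q1 Q2 Q3 Hhat1 Hhat2 Hhat3 : ℕ → ℝ)
    (hH1 : ∀ n, H1 n = -∑ i, (h1 n).eigenvalues i * Real.log ((h1 n).eigenvalues i))
    (hH2 : ∀ n, H2 n = -∑ i, (h2 n).eigenvalues i * Real.log ((h2 n).eigenvalues i))
    (hH3 : ∀ n, H3 n = -∑ i, (h3 n).eigenvalues i * Real.log ((h3 n).eigenvalues i))
    (hQ1 : ∀ n, Q1 n = 1 - ∑ i, ((h1 n).eigenvalues i) ^ 2)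
    (hQ2 : ∀ n, Q2 n = 1 - ∑ i, ((h2 n).eigenvalues i) ^ 2)
    (hQ3 : ∀ n, Q3 n = 1 - ∑ i, ((h3 n).eigenvalues i) ^ 2)
    (hHhat1 : ∀ n, Hhat1 n = -(Q1 n) * Real.log (lmax1 n))
    (hHhat2 : ∀ n, Hhat2 n = -(Q2 n) * Real.log (lmax2 n))
    (hHhat3 : ∀ n, Hhat3 n = -(Q3 n) * Real.log (lmax3 n))
    (JSdiv JSdivF : ℕ → ℝ)
    (hJSdiv : ∀ n, JSdiv n = H3 n - (H1 n + H2 n) / 2)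
    (hJSdivF : ∀ n, JSdivF n = Hhat3 n - (Hhat1 n + Hhat2 n) / 2)
    (α β : ℝ) (hα : 0 < α) (hβ : 0 < β)
    (hbig : ∀ᶠ n in Filter.atTop,
      (α * n ≤ (Nat.card {i : Fin n // 0 < (h1 n).eigenvalues i} : ℝ)
        ∧ lmax1 n < 1 ∧ β * lmax1 n ≤ lmin1 n)
      ∧ (α * n ≤ (Nat.card {i : Fin n // 0 < (h2 n).eigenvalues i} : ℝ)
        ∧ lmax2 n < 1 ∧ β * lmax2 n ≤ lmin2 n)
      ∧ (α * n ≤ (Nat.card {i : Fin n // 0 < (h3 n).eigenvalues i} : ℝ)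
        ∧ lmax3 n < 1 ∧ β * lmax3 n ≤ lmin3 n)) :
    Filter.Tendsto (fun n => (JSdiv n - JSdivF n) / Real.log n) Filter.atTop (nhds 0)
    ∧ (fun n => |Real.sqrt (JSdiv n) - Real.sqrt (max (JSdivF n) 0)|)
        =o[Filter.atTop] (fun n => Real.sqrt (Real.log n)) := by
  have hsymm3 : ∀ n, 2 ≤ n → (Wbar n).IsSymm := fun n hn => by
    rw [hWbar]
    exact ((hsymm n hn).add (hsymm' n hn)).smul _
  have hentry : ∀ n i j, Wbar n i j = (W n i j + W' n i j) / 2 := fun n i j => by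
    rw [hWbar, Matrix.smul_apply, Matrix.add_apply, smul_eq_mul]
    ring
  have hnonneg3 : ∀ n, 2 ≤ n → ∀ i j, 0 ≤ Wbar n i j := fun n hn i j => by
    rw [hentry]
    linarith [hnonneg n hn i j, hnonneg' n hn i j]
  have hdiag3 : ∀ n, 2 ≤ n → ∀ i, Wbar n i i = 0 := fun n hn i => by
    rw [hentry, hdiag n hn, hdiag' n hn]
    norm_num
  have hne3 : ∀ n, 2 ≤ n → Wbar n ≠ 0 := fun n hn h => hne n hn <| Matrix.ext fun i j => by
    have hij := hentry n i j
    rw [h, Matrix.zero_apply] at hij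
    rw [Matrix.zero_apply]
    linarith [hnonneg n hn i j, hnonneg' n hn i j]
  set C : ℝ := 2 * (1 - Real.log β)
  have hbound : ∀ᶠ n in Filter.atTop, |JSdiv n - JSdivF n| ≤ C := by
    filter_upwards [hbig, Filter.eventually_ge_atTop 2] with n hb hn
    obtain ⟨⟨-, -, hb1⟩, ⟨-, -, hb2⟩, -, -, hb3⟩ := hb
    obtain ⟨hp1, hs1⟩ := eigenvalues_normalized_laplacian (W n) (hsymm n hn) (hnonneg n hn)
      (hdiag n hn) (hne n hn) (hLN n _) (h1 n)
    obtain ⟨hp2, hs2⟩ := eigenvalues_normalized_laplacian (W' n) (hsymm' n hn) (hnonneg' n hn)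
      (hdiag' n hn) (hne' n hn) (hLN n _) (h2 n)
    obtain ⟨hp3, hs3⟩ := eigenvalues_normalized_laplacian (Wbar n) (hsymm3 n hn) (hnonneg3 n hn)
      (hdiag3 n hn) (hne3 n hn) (hLN n _) (h3 n)
    have e1 := abs_entropy_sub_finger_le hp1 hs1 (hlmax1 n hn) (hlmin1 n hn) hβ hb1
    have e2 := abs_entropy_sub_finger_le hp2 hs2 (hlmax2 n hn) (hlmin2 n hn) hβ hb2
    have e3 := abs_entropy_sub_finger_le hp3 hs3 (hlmax3 n hn) (hlmin3 n hn) hβ hb3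
    rw [← hH1, ← hQ1, ← hHhat1, abs_le] at e1
    rw [← hH2, ← hQ2, ← hHhat2, abs_le] at e2
    rw [← hH3, ← hQ3, ← hHhat3, abs_le] at e3
    rw [hJSdiv, hJSdivF, abs_le]
    constructor <;> linarith
  have hlog : Filter.Tendsto (fun n : ℕ => Real.log n) Filter.atTop Filter.atTop :=
    Real.tendsto_log_atTop.comp tendsto_natCast_atTop_atTop
  have hO : (fun n => JSdiv n - JSdivF n) =O[Filter.atTop] (fun _ => (1 : ℝ)) :=
    Asymptotics.IsBigO.of_bound C (by simpa using hbound)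
  refine ⟨(hO.trans_isLittleO ?_).tendsto_div_nhds_zero, ?_⟩
  · exact (Asymptotics.isLittleO_const_left).2 (Or.inr (Filter.tendsto_abs_atTop_atTop.comp hlog))
  · have hO' : (fun n => |Real.sqrt (JSdiv n) - Real.sqrt (max (JSdivF n) 0)|)
        =O[Filter.atTop] (fun _ => (1 : ℝ)) := by
      refine Asymptotics.IsBigO.of_bound (Real.sqrt C) ?_
      filter_upwards [hbound] with n hn
      rw [norm_one, mul_one, Real.norm_eq_abs, abs_abs]
      exact (abs_sqrt_sub_sqrt_max_le _ _).trans (Real.sqrt_le_sqrt hn)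
    refine hO'.trans_isLittleO ((Asymptotics.isLittleO_const_left).2 (Or.inr ?_))
    exact Filter.tendsto_abs_atTop_atTop.comp (Real.tendsto_sqrt_atTop.comp hlog)
end
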